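/- arXiv:2210.07261 — 3 statements merged into one kernel-verified Lean document; each statement's English description precedes it below -/
import Mathlib

section
/- If G is a finite group with k conjugacy classes, then the number of conjugacy classes of the wreath product G ≀ S_N equals the number of k-multipartitions of N, i.e., the number of k-tuples (λ₁,…,λ_k) of partitions with |λ₁| + ⋯ + |λ_k| = N. -/
/-- A `k`-multipartition of `N`: a `k`-tuple of partitions whose sizes sum to `N`. -/
def Multipartition (k N : ℕ) : Type :=
  { μ : Fin k → Σ n : ℕ, n.Partition // (∑ i, (μ i).1) = N }

/-- The wreath product `G ≀ S_N`, as the semidirect product `G^N ⋊ S_N` where `S_N`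
permutes the coordinates (equivalently, `N×N` permutation matrices with entries in `G`). -/
abbrev WreathProduct (G : Type*) [Group G] (N : ℕ) : Type _ :=
  (Fin N → G) ⋊[mulAutArrow] Equiv.Perm (Fin N)

namespace Wreath

variable {G ι : Type*} [Group G]

/-- The wreath product `G ≀ Perm ι`, for an arbitrary index type. -/
abbrev Perms (G ι : Type*) [Group G] : Type _ :=
  (ι → G) ⋊[mulAutArrow] Equiv.Perm ι

/-- The group element carried along by `w` when moving the point `x` to `w.right x`. -/
def cocycle (w : Perms G ι) (x : ι) : G := w.left (w.right x)

theorem right_mul (a b : Perms G ι) (x : ι) : (a * b).right x = a.right (b.right x) := rfl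

theorem left_mul (a b : Perms G ι) (x : ι) :
    (a * b).left x = a.left x * b.left (a.right.symm x) := rfl

theorem cocycle_mul (a b : Perms G ι) (x : ι) :
    cocycle (a * b) x = cocycle a (b.right x) * cocycle b x := by
  unfold cocycle
  rw [left_mul, right_mul, Equiv.symm_apply_apply]

theorem cocycle_one (x : ι) : cocycle (1 : Perms G ι) x = 1 := rfl

theorem right_pow (w : Perms G ι) (n : ℕ) : (w ^ n).right = w.right ^ n :=
  map_pow SemidirectProduct.rightHom w n

theorem right_zpow (w : Perms G ι) (n : ℤ) : (w ^ n).right = w.right ^ n :=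
  map_zpow SemidirectProduct.rightHom w n

theorem ext_cocycle {a b : Perms G ι} (hr : ∀ x, a.right x = b.right x)
    (hc : ∀ x, cocycle a x = cocycle b x) : a = b := by
  have h : a.right = b.right := Equiv.ext hr
  refine SemidirectProduct.ext (funext fun x => ?_) h
  have := hc (a.right.symm x)
  unfold cocycle at this
  rwa [← h, Equiv.apply_symm_apply] at this

/-- The length of the cycle of `w` through `x`. -/
noncomputable def period (w : Perms G ι) (x : ι) : ℕ := Function.minimalPeriod w.right x

/-- The product of the group elements along the cycle of `w` through `x`. -/
noncomputable def cycleProduct (w : Perms G ι) (x : ι) : G := cocycle (w ^ period w x) x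

/-- The length and the conjugacy class of the product of the cycle of `w` through `x`. -/
noncomputable def label (w : Perms G ι) (x : ι) : ℕ × ConjClasses G :=
  (period w x, ConjClasses.mk (cycleProduct w x))

theorem pow_right_apply_eq_iff (w : Perms G ι) (x : ι) (n : ℕ) :
    (w ^ n).right x = x ↔ period w x ∣ n := by
  rw [right_pow]
  exact MulAction.pow_smul_eq_iff_minimalPeriod_dvd (a := w.right) (b := x)

theorem zpow_right_apply_eq_iff (w : Perms G ι) (x : ι) (n : ℤ) :
    (w ^ n).right x = x ↔ (period w x : ℤ) ∣ n := by
  rw [right_zpow]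
  exact MulAction.zpow_smul_eq_iff_minimalPeriod_dvd (a := w.right) (b := x)

theorem period_pos [Finite ι] (w : Perms G ι) (x : ι) : 0 < period w x :=
  Function.minimalPeriod_pos_of_mem_periodicPts (w.right.injective.mem_periodicPts x)

/-- If every power of `v` fixes `x` exactly when the same power of `w` fixes `y`,
the periods agree. -/
theorem period_eq {κ : Type*} {v : Perms G ι} {w : Perms G κ} {x : ι} {y : κ}
    (h : ∀ n : ℕ, (v ^ n).right x = x ↔ (w ^ n).right y = y) : period v x = period w y :=
  Nat.dvd_antisymm
    ((pow_right_apply_eq_iff v x _).1 ((h _).2 ((pow_right_apply_eq_iff w y _).2 dvd_rfl)))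
    ((pow_right_apply_eq_iff w y _).1 ((h _).1 ((pow_right_apply_eq_iff v x _).2 dvd_rfl)))

theorem label_eq_of_mul_eq {v w w' : Perms G ι} (h : v * w = w' * v) (x : ι) :
    label w' (v.right x) = label w x := by
  have hpow (n : ℕ) : v * w ^ n = w' ^ n * v := (SemiconjBy.pow_right h n :)
  have hp : period w' (v.right x) = period w x := period_eq fun n => by
    rw [← right_mul, ← hpow, right_mul, v.right.apply_eq_iff_eq]
  refine Prod.ext hp (ConjClasses.mk_eq_mk_iff_isConj.2 (IsConj.symm ?_))
  refine isConj_iff.2 ⟨cocycle v x, ?_⟩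
  have := congrArg (cocycle · x) (hpow (period w x))
  simp only [cocycle_mul, (pow_right_apply_eq_iff w x _).2 dvd_rfl] at this
  rw [mul_inv_eq_iff_eq_mul, cycleProduct, cycleProduct, hp, this]

theorem label_zpow_right_apply (w : Perms G ι) (n : ℤ) (x : ι) :
    label w ((w ^ n).right x) = label w x :=
  label_eq_of_mul_eq ((Commute.refl w).zpow_left n) x

theorem cocycle_zpow_period_mul (w : Perms G ι) (x : ι) (n : ℤ) :
    cocycle (w ^ ((period w x : ℤ) * n)) x = cycleProduct w x ^ n := by
  have hfix : (w ^ period w x).right x = x := (pow_right_apply_eq_iff w x _).2 dvd_rfl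
  have hadd (m : ℤ) : cocycle (w ^ ((period w x : ℤ) * (m + 1))) x
      = cocycle (w ^ ((period w x : ℤ) * m)) x * cycleProduct w x := by
    rw [mul_add_one, zpow_add, zpow_natCast, cocycle_mul, hfix, cycleProduct]
  induction n with
  | zero => simp [cocycle_one]
  | succ n ih => rw [hadd, ih, zpow_add_one]
  | pred n ih =>
    have := hadd (-(n : ℤ) - 1)
    rw [sub_add_cancel, ih] at this
    rw [zpow_sub_one, this, mul_inv_cancel_right]

/-- The set of cycles of `w`. -/
abbrev Cycles (w : Perms G ι) : Type _ := Quotient (Equiv.Perm.SameCycle.setoid w.right)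

theorem exists_zpow_of_mk_eq {w : Perms G ι} {x y : ι}
    (h : (Quotient.mk _ x : Cycles w) = Quotient.mk _ y) : ∃ n : ℤ, (w ^ n).right x = y := by
  obtain ⟨n, hn⟩ := (Quotient.exact h : w.right.SameCycle x y)
  exact ⟨n, by rw [right_zpow, hn]⟩

theorem mk_zpow (w : Perms G ι) (n : ℤ) (x : ι) :
    (Quotient.mk _ ((w ^ n).right x) : Cycles w) = Quotient.mk _ x :=
  (Quotient.sound (⟨n, by rw [right_zpow]⟩ : w.right.SameCycle x _)).symm

/-- The label of a cycle. -/
noncomputable def cycleLabel (w : Perms G ι) (c : Cycles w) : ℕ × ConjClasses G :=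
  label w c.out

theorem cycleLabel_mk (w : Perms G ι) (x : ι) : cycleLabel w (Quotient.mk _ x) = label w x := by
  obtain ⟨n, hn⟩ := exists_zpow_of_mk_eq (Quotient.out_eq (Quotient.mk _ x : Cycles w))
  rw [cycleLabel, ← label_zpow_right_apply w n, hn]

theorem card_cycle [Finite ι] (w : Perms G ι) (c : Cycles w) :
    Nat.card {x : ι // (Quotient.mk _ x : Cycles w) = c} = (cycleLabel w c).1 := by
  have : Fintype (MulAction.orbit (Subgroup.zpowers w.right) c.out) := Fintype.ofFinite _
  refine Eq.trans ?_ (MulAction.minimalPeriod_eq_card w.right c.out).symm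
  rw [← Nat.card_eq_fintype_card]
  refine Nat.card_congr (Equiv.subtypeEquivRight fun x => ?_)
  rw [MulAction.mem_orbit_iff]
  constructor
  · rintro rfl
    obtain ⟨n, hn⟩ := exists_zpow_of_mk_eq (Quotient.out_eq (Quotient.mk _ x : Cycles w))
    exact ⟨⟨_, n, rfl⟩, by rw [right_zpow] at hn; exact hn⟩
  · rintro ⟨⟨_, n, rfl⟩, hn⟩
    have : (w ^ n).right c.out = x := by rw [right_zpow]; exact hn
    rw [← this, mk_zpow, Quotient.out_eq]

/-- If the fibres of `f` have size prescribed by a labelling of the target, the number of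
points with a given label is the number of labels times that size. -/
theorem card_fiber_mul {α β C : Type*} [Finite α] [Finite β] {f : α → β} {l : α → ℕ × C}
    {l' : β → ℕ × C} (h : ∀ x, l' (f x) = l x)
    (hf : ∀ b, Nat.card {x // f x = b} = (l' b).1) (q : ℕ × C) :
    Nat.card {x // l x = q} = q.1 * Nat.card {b // l' b = q} := by
  have := Fintype.ofFinite {b // l' b = q}
  rw [← Nat.card_congr (Equiv.sigmaSubtypeFiberEquivSubtype f (q := fun b => l' b = q)
    fun x => by rw [h]), Nat.card_sigma, Finset.sum_congr rfl fun b _ => (hf b.1).trans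
      (congrArg Prod.fst b.2), Finset.sum_const, smul_eq_mul, Finset.card_univ,
      Nat.card_eq_fintype_card, mul_comm]

theorem card_label [Finite ι] (w : Perms G ι) (q : ℕ × ConjClasses G) :
    Nat.card {x // label w x = q} = q.1 * Nat.card {c // cycleLabel w c = q} :=
  card_fiber_mul (cycleLabel_mk w) (card_cycle w) q

theorem exists_cycles_equiv [Finite ι] {w w' : Perms G ι}
    (h : ∀ q, Nat.card {x // label w x = q} = Nat.card {x // label w' x = q}) :
    ∃ e : Cycles w ≃ Cycles w', ∀ c, cycleLabel w' (e c) = cycleLabel w c := by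
  have key (q) : Nonempty ({c // cycleLabel w c = q} ≃ {c // cycleLabel w' c = q}) := by
    refine Finite.card_eq.1 ?_
    rcases Nat.eq_zero_or_pos q.1 with hq | hq
    · have (u : Perms G ι) : IsEmpty {c // cycleLabel u c = q} :=
        ⟨fun c => (period_pos u c.1.out).ne' ((congrArg Prod.fst c.2).trans hq)⟩
      rw [Nat.card_of_isEmpty, Nat.card_of_isEmpty]
    · have := h q
      rw [card_label, card_label] at this
      exact Nat.eq_of_mul_eq_mul_left hq this
  exact ⟨Equiv.ofFiberEquiv fun q => (key q).some, Equiv.ofFiberEquiv_map _⟩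

/-- The cocycle at the point `w ^ i • x` of the element conjugating `w` to `w'` that moves `x`
to `y` with cocycle `k` there. -/
def transport (w w' : Perms G ι) (x y : ι) (k : G) (i : ℤ) : G :=
  cocycle (w' ^ i) y * k * (cocycle (w ^ i) x)⁻¹

theorem transport_succ (w w' : Perms G ι) (x y : ι) (k : G) (i : ℤ) :
    transport w w' x y k (1 + i) * cocycle w ((w ^ i).right x) =
      cocycle w' ((w' ^ i).right y) * transport w w' x y k i := by
  simp only [transport, zpow_add, zpow_one, cocycle_mul, mul_inv_rev]
  group

theorem zpow_right_eq_iff (w : Perms G ι) (x : ι) (i j : ℤ) :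
    (w ^ i).right x = (w ^ j).right x ↔ (period w x : ℤ) ∣ j - i := by
  rw [← zpow_right_apply_eq_iff, ← (w ^ i).right.apply_eq_iff_eq (x := (w ^ (j - i)).right x),
    ← right_mul, ← zpow_add, add_sub_cancel, eq_comm]

theorem transport_congr {w w' : Perms G ι} {x y : ι} {k : G} (hp : period w' y = period w x)
    (hk : k * cycleProduct w x * k⁻¹ = cycleProduct w' y) {i j : ℤ}
    (h : (w ^ i).right x = (w ^ j).right x) :
    transport w w' x y k i = transport w w' x y k j := by
  rw [zpow_right_eq_iff] at h
  obtain ⟨d, hd⟩ := h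
  obtain rfl : j = i + period w x * d := by omega
  have h1 : (w ^ ((period w x : ℤ) * d)).right x = x :=
    (zpow_right_apply_eq_iff w x _).2 (dvd_mul_right _ _)
  have h2 : (w' ^ ((period w x : ℤ) * d)).right y = y :=
    (zpow_right_apply_eq_iff w' y _).2 (hp ▸ dvd_mul_right _ _)
  have h3 := cocycle_zpow_period_mul w' y d
  rw [hp, ← hk, conj_zpow] at h3
  simp only [transport, zpow_add, cocycle_mul, h1, h2, h3, cocycle_zpow_period_mul]
  group

theorem isConj_of_card_label_eq [Finite ι] {w w' : Perms G ι}
    (h : ∀ q, Nat.card {x // label w x = q} = Nat.card {x // label w' x = q}) :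
    IsConj w w' := by
  obtain ⟨e, he⟩ := exists_cycles_equiv h
  have hp (c : Cycles w) : period w' (e c).out = period w c.out := congrArg Prod.fst (he c)
  have hconj (c : Cycles w) :
      ∃ k, k * cycleProduct w c.out * k⁻¹ = cycleProduct w' (e c).out :=
    isConj_iff.1 (ConjClasses.mk_eq_mk_iff_isConj.1 (congrArg Prod.snd (he c)).symm)
  choose k hk using hconj
  choose i hi using fun x : ι =>
    exists_zpow_of_mk_eq (Quotient.out_eq (Quotient.mk _ x : Cycles w))
  have hiff (c : Cycles w) (a b : ℤ) : (w ^ a).right c.out = (w ^ b).right c.out ↔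
      (w' ^ a).right (e c).out = (w' ^ b).right (e c).out := by
    rw [zpow_right_eq_iff, zpow_right_eq_iff, hp]
  let cyc (x : ι) : Cycles w := Quotient.mk _ x
  let τ (x : ι) : ι := (w' ^ i x).right (e (cyc x)).out
  have hτ : Function.Injective τ := by
    intro x y hxy
    have hc : cyc x = cyc y := by
      have := congrArg (Quotient.mk _ : ι → Cycles w') hxy
      simp only [τ, mk_zpow, Quotient.out_eq] at this
      exact e.injective this
    have hxy' : (w' ^ i x).right (e (cyc x)).out = (w' ^ i y).right (e (cyc x)).out := by
      rw [show (w' ^ i x).right (e (cyc x)).out = τ x from rfl, hxy, hc]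
    rw [← hiff] at hxy'
    rw [← hi x, ← hi y]
    exact hxy'.trans (by rw [hc])
  let t : Equiv.Perm ι := Equiv.ofBijective τ (Finite.injective_iff_bijective.1 hτ)
  let B (x : ι) : G := transport w w' (cyc x).out (e (cyc x)).out (k (cyc x)) (i x)
  let v : Perms G ι := ⟨fun y => B (t.symm y), t⟩
  have hv (x : ι) : cocycle v x = B x := congrArg B (t.symm_apply_apply x)
  have hvr (x : ι) : v.right x = (w' ^ i x).right (e (cyc x)).out := rfl
  have hcyc (x : ι) : cyc (w.right x) = cyc x := by
    simpa only [zpow_one] using mk_zpow w 1 x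
  have hstep (x : ι) :
      (w ^ i (w.right x)).right (cyc x).out = (w ^ (1 + i x)).right (cyc x).out := by
    rw [zpow_add, zpow_one, right_mul, hi x, ← hcyc x, hi]
  refine isConj_iff.2 ⟨v, mul_inv_eq_iff_eq_mul.2 (ext_cocycle (fun x => ?_) fun x => ?_)⟩
  · rw [right_mul, right_mul, hvr, hvr, hcyc, (hiff _ _ _).1 (hstep x), zpow_add, zpow_one,
      right_mul]
  · rw [cocycle_mul, cocycle_mul, hv, hv, hvr]
    have h1 : B (w.right x) =
        transport w w' (cyc x).out (e (cyc x)).out (k (cyc x)) (1 + i x) := by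
      rw [← transport_congr (hp _) (hk _) (hstep x)]
      simp only [B, hcyc]
    have h2 := transport_succ w w' (cyc x).out (e (cyc x)).out (k (cyc x)) (i x)
    rw [hi x] at h2
    rw [h1, h2]

theorem card_label_eq_of_isConj {w w' : Perms G ι} (h : IsConj w w') (q : ℕ × ConjClasses G) :
    Nat.card {x // label w x = q} = Nat.card {x // label w' x = q} := by
  obtain ⟨v, hv⟩ := isConj_iff.1 h
  exact Nat.card_congr (v.right.subtypeEquiv fun x => by
    rw [label_eq_of_mul_eq (mul_inv_eq_iff_eq_mul.1 hv)])

/-- If all but the first of the elements along a cycle are trivial, the first one is the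
product of the cycle. -/
theorem cocycle_pow_of_eq_one (w : Perms G ι) (x : ι) (n : ℕ)
    (h : ∀ i < n, i ≠ 0 → cocycle w ((w ^ i).right x) = 1) (hn : n ≠ 0) :
    cocycle (w ^ n) x = cocycle w x := by
  induction n with
  | zero => exact absurd rfl hn
  | succ n ih =>
    rcases eq_or_ne n 0 with rfl | hn'
    · rw [zero_add, pow_one]
    · rw [pow_succ', cocycle_mul, h n n.lt_succ_self hn', one_mul,
        ih (fun i hi => h i (hi.trans n.lt_succ_self)) hn']

theorem exists_card_label_eq [Finite ι] {Ω : Type*} [Fintype Ω] (l : Ω → ℕ × ConjClasses G)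
    (hl : ∀ ω, (l ω).1 ≠ 0) (hsum : ∑ ω, (l ω).1 = Nat.card ι) :
    ∃ w : Perms G ι, ∀ q,
      Nat.card {x // label w x = q} = q.1 * Nat.card {ω // l ω = q} := by
  have (ω : Ω) : NeZero (l ω).1 := ⟨hl ω⟩
  obtain ⟨e⟩ : Nonempty (ι ≃ Σ ω, ZMod (l ω).1) := by
    refine Finite.card_eq.1 ?_
    rw [Nat.card_sigma, ← hsum]
    exact Finset.sum_congr rfl fun ω _ => (Nat.card_zmod _).symm
  choose g hg using fun ω => ConjClasses.exists_rep (l ω).2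
  classical
  let σ : Equiv.Perm ι := e.symm.permCongr
    (Equiv.sigmaCongrRight fun ω => Equiv.addRight (1 : ZMod (l ω).1))
  let w : Perms G ι := ⟨fun x => if (e x).2 = 1 then g (e x).1 else 1, σ⟩
  have hstep (ω : Ω) (a : ZMod (l ω).1) : w.right (e.symm ⟨ω, a⟩) = e.symm ⟨ω, a + 1⟩ := by
    simp [w, σ]
  have hpow (ω : Ω) (n : ℕ) : (w ^ n).right (e.symm ⟨ω, 0⟩) = e.symm ⟨ω, n⟩ := by
    induction n with
    | zero => rw [Nat.cast_zero]; rfl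
    | succ n ih => rw [pow_succ', right_mul, ih, hstep, Nat.cast_succ]
  have hleft (z) : w.left (e.symm z) = if z.2 = 1 then g z.1 else 1 := by
    obtain ⟨x, rfl⟩ := e.surjective z
    rw [e.symm_apply_apply]
  have hcoc (ω : Ω) (a : ZMod (l ω).1) :
      cocycle w (e.symm ⟨ω, a⟩) = if a = 0 then g ω else 1 := by
    rw [cocycle, hstep, hleft]
    simp
  have hdvd (ω : Ω) (n : ℕ) : (w ^ n).right (e.symm ⟨ω, 0⟩) = e.symm ⟨ω, 0⟩ ↔ (l ω).1 ∣ n := by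
    rw [hpow, e.symm.apply_eq_iff_eq, ← ZMod.natCast_eq_zero_iff]
    simp
  have hper (ω : Ω) : period w (e.symm ⟨ω, 0⟩) = (l ω).1 :=
    Nat.dvd_antisymm ((pow_right_apply_eq_iff w _ _).1 ((hdvd ω _).2 dvd_rfl))
      ((hdvd ω _).1 ((pow_right_apply_eq_iff w _ _).2 dvd_rfl))
  have hlabel (x : ι) : l (e x).1 = label w x := by
    obtain ⟨⟨ω, a⟩, rfl⟩ := e.symm.surjective x
    have hx : (w ^ a.val).right (e.symm ⟨ω, 0⟩) = e.symm ⟨ω, a⟩ := by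
      rw [hpow, ZMod.natCast_zmod_val]
    have := label_zpow_right_apply w a.val (e.symm ⟨ω, 0⟩)
    rw [zpow_natCast, hx] at this
    rw [this, e.apply_symm_apply]
    refine Prod.ext (hper ω).symm ?_
    rw [label, cycleProduct, hper, cocycle_pow_of_eq_one w _ _ _ (hl ω), hcoc, if_pos rfl, hg]
    intro i hi hi0
    rw [hpow, hcoc, if_neg]
    rw [ZMod.natCast_eq_zero_iff]
    exact Nat.not_dvd_of_pos_of_lt (Nat.pos_of_ne_zero hi0) hi
  refine ⟨w, card_fiber_mul (f := fun x => (e x).1) hlabel fun ω => ?_⟩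
  rw [← Nat.card_zmod (l ω).1]
  exact Nat.card_congr ((e.subtypeEquiv fun x => Iff.rfl).trans (Equiv.sigmaSubtype ω))

end Wreath

/-- Multipartitions are determined by the multisets of parts. -/
theorem Multipartition.ext_parts {k N : ℕ} {μ ν : Multipartition k N}
    (h : ∀ i, (μ.1 i).2.parts = (ν.1 i).2.parts) : μ = ν := by
  refine Subtype.ext (funext fun i => ?_)
  have hi := h i
  generalize μ.1 i = a at hi
  generalize ν.1 i = b at hi
  obtain ⟨m, P⟩ := a
  obtain ⟨n, Q⟩ := b
  obtain rfl : m = n := by rw [← P.parts_sum, ← Q.parts_sum]; exact congrArg _ hi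
  exact congrArg _ (Nat.Partition.ext hi)

namespace Wreath

variable {G : Type*} [Group G] {k N : ℕ}

/-- The multipartition `μ` records the cycles of `w`: the partition at the index of a conjugacy
class lists the lengths of the cycles whose product lies in that class. -/
def HasType (ε : ConjClasses G ≃ Fin k) (w : WreathProduct G N) (μ : Multipartition k N) : Prop :=
  ∀ q, Nat.card {x // label w x = q} = q.1 * (μ.1 (ε q.2)).2.parts.count q.1

theorem HasType.unique {ε : ConjClasses G ≃ Fin k} {w : WreathProduct G N}
    {μ ν : Multipartition k N} (hμ : HasType ε w μ) (hν : HasType ε w ν) : μ = ν := by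
  refine Multipartition.ext_parts fun i => Multiset.ext.2 fun n => ?_
  rcases Nat.eq_zero_or_pos n with rfl | hn
  · have h0 (P : Σ n : ℕ, n.Partition) : P.2.parts.count 0 = 0 :=
      Multiset.count_eq_zero.2 fun h => (P.2.parts_pos h).false
    rw [h0, h0]
  · have := (hμ (n, ε.symm i)).symm.trans (hν (n, ε.symm i))
    rw [ε.apply_symm_apply] at this
    exact Nat.eq_of_mul_eq_mul_left hn this

theorem exists_hasType (ε : ConjClasses G ≃ Fin k) (w : WreathProduct G N) :
    ∃ μ, HasType ε w μ := by
  classical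
  have := Fintype.ofFinite (Cycles w)
  let s (i : Fin k) : Finset (Cycles w) := {c | ε (cycleLabel w c).2 = i}
  let m (i : Fin k) : Multiset ℕ := (s i).val.map fun c => (cycleLabel w c).1
  have hpos (i) {n} (hn : n ∈ m i) : 0 < n := by
    obtain ⟨c, -, rfl⟩ := Multiset.mem_map.1 hn
    exact period_pos w c.out
  have hsum : ∑ i, (m i).sum = N := by
    calc ∑ i, (m i).sum = ∑ c, (cycleLabel w c).1 :=
          Finset.sum_fiberwise Finset.univ (fun c => ε (cycleLabel w c).2)
            fun c => (cycleLabel w c).1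
      _ = ∑ c, Nat.card {x // (Quotient.mk _ x : Cycles w) = c} :=
          Finset.sum_congr rfl fun c _ => (card_cycle w c).symm
      _ = N := by
          rw [← Nat.card_sigma, Nat.card_congr (Equiv.sigmaFiberEquiv _), Nat.card_fin]
  refine ⟨⟨fun i => ⟨(m i).sum, ⟨m i, hpos i, rfl⟩⟩, hsum⟩, fun q => ?_⟩
  rw [card_label]
  congr 1
  change _ = Multiset.count q.1 (m (ε q.2))
  rw [Multiset.count_map, Nat.card_eq_fintype_card, Fintype.card_subtype, Finset.card_def]
  simp only [s, Finset.filter_val, Multiset.filter_filter, ε.apply_eq_iff_eq, Prod.ext_iff,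
    eq_comm (a := q.1)]

theorem exists_perms_hasType (ε : ConjClasses G ≃ Fin k) (μ : Multipartition k N) :
    ∃ w : WreathProduct G N, HasType ε w μ := by
  have := Fintype.ofEquiv _ ε.symm
  let l (ω : Σ c, (μ.1 (ε c)).2.parts.ToType) : ℕ × ConjClasses G := (ω.2.1, ω.1)
  obtain ⟨w, hw⟩ := exists_card_label_eq (ι := Fin N) l
    (fun ω => ((μ.1 (ε ω.1)).2.parts_pos (Multiset.coe_mem (x := ω.2))).ne') (by
      rw [Nat.card_fin]
      refine Eq.trans ?_ ((ε.sum_comp fun i => (μ.1 i).1).trans μ.2)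
      rw [Fintype.sum_sigma]
      refine Finset.sum_congr rfl fun c _ => ?_
      exact (congrArg Multiset.sum (Multiset.map_univ_coe _)).trans (μ.1 (ε c)).2.parts_sum)
  refine ⟨w, fun q => ?_⟩
  rw [hw]
  congr 1
  conv_rhs => rw [← Multiset.map_univ_coe (μ.1 (ε q.2)).2.parts]
  rw [Multiset.count_map, ← Finset.filter_val, ← Finset.card_def, ← Fintype.card_subtype,
    ← Nat.card_eq_fintype_card]
  refine (Nat.card_congr (Equiv.ofBijective
    (fun a => ⟨⟨q.2, a.1⟩, Prod.ext a.2.symm rfl⟩) ⟨?_, ?_⟩)).symm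
  · rintro ⟨a, ha⟩ ⟨b, hb⟩ h
    simpa using h
  · rintro ⟨⟨c, a⟩, rfl⟩
    exact ⟨⟨a, rfl⟩, rfl⟩

end Wreath

/-- If `G` is a finite group with `k` conjugacy classes, then the number of
conjugacy classes of `G ≀ S_N` equals the number of `k`-multipartitions of `N`. -/
theorem card_conjClasses_wreathProduct (G : Type*) [Group G] [Finite G] (N : ℕ) :
    Nat.card (ConjClasses (WreathProduct G N)) =
      Nat.card (Multipartition (Nat.card (ConjClasses G)) N) := by
  let ε : ConjClasses G ≃ Fin (Nat.card (ConjClasses G)) := Finite.equivFin _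
  choose F hF using Wreath.exists_hasType (N := N) ε
  have hconj (v w : WreathProduct G N) : IsConj v w ↔ F v = F w := by
    refine ⟨fun h => (hF v).unique fun q => ?_, fun h => Wreath.isConj_of_card_label_eq fun q => ?_⟩
    · rw [Wreath.card_label_eq_of_isConj h, hF w q]
    · rw [hF v q, hF w q, h]
  refine Nat.card_eq_of_bijective (Quotient.lift F fun v w h => (hconj v w).1 h) ⟨?_, fun μ => ?_⟩
  · rintro ⟨v⟩ ⟨w⟩ h
    exact Quotient.sound ((hconj v w).2 h)
  · obtain ⟨w, hw⟩ := Wreath.exists_perms_hasType ε μ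
    exact ⟨ConjClasses.mk w, (hF w).unique hw⟩
end

section
/- For fixed k ≥ 2 and any δ > 0, the proportion of k-multipartitions λ = (λ₁,…,λ_k) of N satisfying (N/k)(1−δ) < |λ_i| < (N/k)(1+δ) for all 1 ≤ i ≤ k tends to 1 as N → ∞. -/
open Filter

open Finset in
theorem card_restricted_le_succ_of_lt {M n : ℕ} (h : n < M + 1) :
    #(Nat.Partition.restricted n (· ≤ M + 1)) = #(Nat.Partition.restricted n (· ≤ M)) := by
  congr 1
  ext p
  simp only [Nat.Partition.restricted, mem_filter, mem_univ, true_and]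
  refine ⟨fun _ i hi => ?_, fun hp i hi => (hp i hi).trans M.le_succ⟩
  have := Nat.Partition.le_of_mem_parts hi
  omega

open Finset in
theorem card_restricted_le_succ_add (M n : ℕ) :
    #(Nat.Partition.restricted (n + (M + 1)) (· ≤ M + 1)) =
      #(Nat.Partition.restricted (n + (M + 1)) (· ≤ M)) +
        #(Nat.Partition.restricted n (· ≤ M + 1)) := by
  rw [← card_filter_add_card_filter_not
    (s := Nat.Partition.restricted (n + (M + 1)) (· ≤ M + 1)) (fun p => M + 1 ∉ p.parts)]
  congr 1
  · congr 1
    ext p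
    simp only [Nat.Partition.restricted, mem_filter, mem_univ, true_and]
    constructor
    · rintro ⟨h, h'⟩ i hi
      have := h i hi
      have : i ≠ M + 1 := fun e => h' (e ▸ hi)
      omega
    · intro h
      refine ⟨fun i hi => (h i hi).trans M.le_succ, fun hi => ?_⟩
      have := h _ hi
      omega
  · symm
    refine card_bij (fun q _ => ⟨(M + 1) ::ₘ q.parts, ?_, ?_⟩) ?_ ?_ ?_
    · intro i hi
      rcases Multiset.mem_cons.1 hi with rfl | hi
      · exact M.succ_pos
      · exact q.parts_pos hi
    · rw [Multiset.sum_cons, q.parts_sum, add_comm]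
    · intro q hq
      simp only [Nat.Partition.restricted, mem_filter, mem_univ, true_and] at hq ⊢
      refine ⟨fun i hi => ?_, by simp⟩
      rcases Multiset.mem_cons.1 hi with rfl | hi
      · exact le_rfl
      · exact hq i hi
    · intro q _ q' _ h
      exact Nat.Partition.ext ((Multiset.cons_inj_right _).1 (congrArg Nat.Partition.parts h))
    · intro p hp
      simp only [Nat.Partition.restricted, mem_filter, mem_univ, true_and, not_not] at hp
      refine ⟨⟨p.parts.erase (M + 1), fun hi => p.parts_pos (Multiset.mem_of_mem_erase hi), ?_⟩,
        ?_, ?_⟩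
      · have := congrArg Multiset.sum (Multiset.cons_erase hp.2)
        rw [Multiset.sum_cons, p.parts_sum] at this
        omega
      · simp only [Nat.Partition.restricted, mem_filter, mem_univ, true_and]
        exact fun i hi => hp.1 i (Multiset.mem_of_mem_erase hi)
      · exact Nat.Partition.ext (Multiset.cons_erase hp.2)

open Finset in
theorem hasSum_card_restricted_le {x : ℝ} (h0 : 0 < x) (h1 : x < 1) (M : ℕ) :
    HasSum (fun n => (#(Nat.Partition.restricted n (· ≤ M)) : ℝ) * x ^ n)
      (∏ i ∈ range M, (1 - x ^ (i + 1))⁻¹) := by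
  induction M with
  | zero =>
    have : HasSum (fun n => (#(Nat.Partition.restricted n (· ≤ 0)) : ℝ) * x ^ n)
        ((#(Nat.Partition.restricted 0 (· ≤ 0)) : ℝ) * x ^ 0) := by
      refine hasSum_single 0 fun n hn => ?_
      have : Nat.Partition.restricted n (· ≤ 0) = ∅ := by
        refine eq_empty_of_forall_notMem fun p hp => hn ?_
        simp only [Nat.Partition.restricted, mem_filter, mem_univ, true_and] at hp
        rw [← p.parts_sum]
        exact Multiset.sum_eq_zero fun i hi => Nat.le_zero.1 (hp i hi)
      rw [this]
      simp
    simpa [Nat.Partition.restricted] using this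
  | succ M ih =>
    set a : ℕ → ℝ := fun n => (#(Nat.Partition.restricted n (· ≤ M)) : ℝ) * x ^ n with ha
    set b : ℕ → ℝ := fun n => (#(Nat.Partition.restricted n (· ≤ M + 1)) : ℝ) * x ^ n with hb
    set P := ∏ i ∈ range M, (1 - x ^ (i + 1))⁻¹
    have hxd : x ^ (M + 1) < 1 := pow_lt_one₀ h0.le h1 (by omega)
    have ha0 : ∀ n, 0 ≤ a n := fun n => by positivity
    have hb0 : ∀ n, 0 ≤ b n := fun n => by positivity
    have hlt : ∀ n ∈ range (M + 1), b n = a n := fun n hn => by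
      simp only [ha, hb, card_restricted_le_succ_of_lt (mem_range.1 hn)]
    have hadd : ∀ n, b (n + (M + 1)) = a (n + (M + 1)) + x ^ (M + 1) * b n := fun n => by
      simp only [ha, hb, card_restricted_le_succ_add]
      push_cast
      ring
    have hsum : Summable b := by
      refine summable_of_sum_range_le (c := P * (1 - x ^ (M + 1))⁻¹) hb0 fun K => ?_
      have hle : ∑ n ∈ range K, b n ≤ ∑ n ∈ range (M + 1 + K), b n :=
        sum_le_sum_of_subset_of_nonneg (range_mono (by omega)) fun n _ _ => hb0 n
      have heq : ∑ n ∈ range (M + 1 + K), b n =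
          ∑ n ∈ range (M + 1 + K), a n + x ^ (M + 1) * ∑ n ∈ range K, b n := by
        rw [sum_range_add _ (M + 1) K, sum_range_add _ (M + 1) K, sum_congr rfl hlt,
          mul_sum, add_assoc, ← sum_add_distrib]
        congr 1
        exact sum_congr rfl fun n _ => by rw [add_comm (M + 1) n, hadd]
      have hP : ∑ n ∈ range (M + 1 + K), a n ≤ P := sum_le_hasSum _ (fun n _ => ha0 n) ih
      rw [← div_eq_mul_inv, le_div_iff₀ (by linarith)]
      linarith
    have hT := hsum.sum_add_tsum_nat_add (M + 1)
    have hPs := ih.summable.sum_add_tsum_nat_add (M + 1)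
    rw [ih.tsum_eq] at hPs
    simp only [hadd] at hT
    rw [((summable_nat_add_iff (M + 1)).2 ih.summable).tsum_add (hsum.mul_left _), tsum_mul_left,
      sum_congr rfl hlt] at hT
    have : ∑' n, b n = P * (1 - x ^ (M + 1))⁻¹ := by
      rw [← div_eq_mul_inv, eq_div_iff (by linarith)]
      linarith
    rw [prod_range_succ, ← this]
    exact hsum.hasSum

theorem card_partition_mono : Monotone fun n : ℕ => Fintype.card n.Partition := by
  refine monotone_nat_of_le_succ fun n => ?_
  refine Fintype.card_le_of_injective
    (fun q : n.Partition => (⟨1 ::ₘ q.parts, ?_, ?_⟩ : (n + 1).Partition)) ?_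
  · intro i hi
    rcases Multiset.mem_cons.1 hi with rfl | hi
    · exact one_pos
    · exact q.parts_pos hi
  · rw [Multiset.sum_cons, q.parts_sum, add_comm]
  · intro q q' h
    exact Nat.Partition.ext ((Multiset.cons_inj_right _).1 (congrArg Nat.Partition.parts h))

open Finset in
theorem hasSum_log_prod_inv_one_sub_exp {s : ℝ} (hs : 0 < s) (M : ℕ) :
    HasSum (fun j : ℕ => (∑ i ∈ range M, Real.exp (-(s * (j + 1))) ^ (i + 1)) / (j + 1))
      (Real.log (∏ i ∈ range M, (1 - Real.exp (-s) ^ (i + 1))⁻¹)) := by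
  have hlt : ∀ i : ℕ, Real.exp (-s) ^ (i + 1) < 1 := fun i =>
    pow_lt_one₀ (Real.exp_pos _).le (Real.exp_lt_one_iff.2 (by linarith)) (by omega)
  rw [Real.log_prod fun i _ => inv_ne_zero (by linarith [hlt i])]
  simp only [sum_div, Real.log_inv]
  refine hasSum_sum fun i _ => ?_
  have habs : |Real.exp (-s) ^ (i + 1)| < 1 := by
    rw [abs_of_pos (by positivity)]
    exact hlt i
  convert Real.hasSum_pow_div_log_of_abs_lt_one habs using 3 with j
  rw [← pow_mul, mul_comm (i + 1), pow_mul, ← Real.exp_nat_mul (-s)]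
  push_cast
  congr 2
  ring

theorem hasSum_inv_succ_sq : HasSum (fun j : ℕ => 1 / ((j : ℝ) + 1) ^ 2) (Real.pi ^ 2 / 6) := by
  simpa using (hasSum_nat_add_iff' 1).2 hasSum_zeta_two

theorem exp_neg_div_one_sub_exp_neg_le {t : ℝ} (ht : 0 < t) :
    Real.exp (-t) / (1 - Real.exp (-t)) ≤ 1 / t := by
  have h1 : Real.exp (-t) < 1 := Real.exp_lt_one_iff.2 (by linarith)
  have h2 : Real.exp (-t) * (t + 1) ≤ 1 := by
    calc Real.exp (-t) * (t + 1) ≤ Real.exp (-t) * Real.exp t := by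
          gcongr; exact Real.add_one_le_exp t
      _ = 1 := by rw [← Real.exp_add]; simp
  rw [div_le_div_iff₀ (by linarith) ht]
  linarith

theorem le_exp_neg_div_one_sub_exp_neg {t : ℝ} (ht : 0 < t) :
    1 / t - 1 ≤ Real.exp (-t) / (1 - Real.exp (-t)) := by
  have h1 : Real.exp (-t) < 1 := Real.exp_lt_one_iff.2 (by linarith)
  have h2 := Real.add_one_le_exp (-t)
  rw [div_sub_one ht.ne', div_le_div_iff₀ ht (by linarith)]
  linarith

theorem hasSum_exp_neg_pow_succ {t : ℝ} (ht : 0 < t) :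
    HasSum (fun i : ℕ => Real.exp (-t) ^ (i + 1)) (Real.exp (-t) / (1 - Real.exp (-t))) := by
  have h1 : Real.exp (-t) < 1 := Real.exp_lt_one_iff.2 (by linarith)
  simpa [pow_succ', div_eq_mul_inv] using
    (hasSum_geometric_of_lt_one (Real.exp_pos _).le h1).mul_left (Real.exp (-t))

open Finset in
theorem prod_inv_one_sub_exp_le {s : ℝ} (hs : 0 < s) (M : ℕ) :
    ∏ i ∈ range M, (1 - Real.exp (-s) ^ (i + 1))⁻¹ ≤ Real.exp (Real.pi ^ 2 / 6 / s) := by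
  have hlt : ∀ i : ℕ, Real.exp (-s) ^ (i + 1) < 1 := fun i =>
    pow_lt_one₀ (Real.exp_pos _).le (Real.exp_lt_one_iff.2 (by linarith)) (by omega)
  rw [← Real.log_le_iff_le_exp (prod_pos fun i _ => inv_pos.2 (by linarith [hlt i]))]
  refine hasSum_le (fun j => ?_) (hasSum_log_prod_inv_one_sub_exp hs M)
    (hasSum_inv_succ_sq.div_const s)
  have ht : 0 < s * (j + 1) := by positivity
  calc (∑ i ∈ range M, Real.exp (-(s * (j + 1))) ^ (i + 1)) / ((j : ℝ) + 1)
      ≤ 1 / (s * (j + 1)) / ((j : ℝ) + 1) := by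
        gcongr
        exact (sum_le_hasSum _ (fun _ _ => by positivity) (hasSum_exp_neg_pow_succ ht)).trans
          (exp_neg_div_one_sub_exp_neg_le ht)
    _ = 1 / ((j : ℝ) + 1) ^ 2 / s := by field_simp

open Finset in
theorem card_restricted_le_self (M n : ℕ) :
    #(Nat.Partition.restricted n (· ≤ M)) ≤ Fintype.card n.Partition :=
  card_le_univ _

open Finset in
theorem card_restricted_of_le {M n : ℕ} (h : n ≤ M) :
    #(Nat.Partition.restricted n (· ≤ M)) = Fintype.card n.Partition := by
  rw [← card_univ]
  congr 1
  ext p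
  simpa [Nat.Partition.restricted] using
    fun i hi => (Nat.Partition.le_of_mem_parts hi).trans h

open Finset in
theorem sum_range_card_partition_le {s : ℝ} (hs : 0 < s) (K : ℕ) :
    ∑ n ∈ range K, (Fintype.card n.Partition : ℝ) * Real.exp (-s) ^ n ≤
      Real.exp (Real.pi ^ 2 / 6 / s) := by
  refine le_trans ?_ (prod_inv_one_sub_exp_le hs K)
  rw [sum_congr rfl fun n hn => by rw [← card_restricted_of_le (mem_range.1 hn).le]]
  exact sum_le_hasSum _ (fun _ _ => by positivity)
    (hasSum_card_restricted_le (Real.exp_pos _) (Real.exp_lt_one_iff.2 (by linarith)) K)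

theorem summable_card_partition {s : ℝ} (hs : 0 < s) :
    Summable fun n : ℕ => (Fintype.card n.Partition : ℝ) * Real.exp (-s) ^ n :=
  summable_of_sum_range_le (fun _ => by positivity) (sum_range_card_partition_le hs)

theorem card_partition_mul_exp_le {s : ℝ} (hs : 0 < s) (n : ℕ) :
    (Fintype.card n.Partition : ℝ) * Real.exp (-s) ^ n ≤ Real.exp (Real.pi ^ 2 / 6 / s) :=
  (Finset.single_le_sum (f := fun n : ℕ => (Fintype.card n.Partition : ℝ) * Real.exp (-s) ^ n)
    (fun _ _ => by positivity) (Finset.self_mem_range_succ n)).trans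
    (sum_range_card_partition_le hs (n + 1))

open Finset in
theorem le_tsum_card_partition {s : ℝ} (hs : 0 < s) (J : ℕ) :
    Real.exp ((∑ j ∈ range J, 1 / ((j : ℝ) + 1) ^ 2) / s - J) ≤
      ∑' n : ℕ, (Fintype.card n.Partition : ℝ) * Real.exp (-s) ^ n := by
  have hx1 : Real.exp (-s) < 1 := Real.exp_lt_one_iff.2 (by linarith)
  have hlt : ∀ i : ℕ, Real.exp (-s) ^ (i + 1) < 1 := fun i =>
    pow_lt_one₀ (Real.exp_pos _).le hx1 (by omega)
  have hM : ∀ M : ℕ,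
      Real.exp (∑ j ∈ range J,
        (∑ i ∈ range M, Real.exp (-(s * (j + 1))) ^ (i + 1)) / ((j : ℝ) + 1)) ≤
      ∑' n : ℕ, (Fintype.card n.Partition : ℝ) * Real.exp (-s) ^ n := fun M => by
    calc _ ≤ ∏ i ∈ range M, (1 - Real.exp (-s) ^ (i + 1))⁻¹ := by
          rw [← Real.le_log_iff_exp_le (prod_pos fun i _ => inv_pos.2 (by linarith [hlt i]))]
          exact sum_le_hasSum _ (fun _ _ => by positivity) (hasSum_log_prod_inv_one_sub_exp hs M)
      _ ≤ _ := by
          refine hasSum_le (fun n => ?_) (hasSum_card_restricted_le (Real.exp_pos _) hx1 M)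
            (summable_card_partition hs).hasSum
          gcongr
          exact card_restricted_le_self M n
  have hlim : Tendsto (fun M : ℕ => Real.exp (∑ j ∈ range J,
        (∑ i ∈ range M, Real.exp (-(s * (j + 1))) ^ (i + 1)) / ((j : ℝ) + 1))) atTop
      (nhds (Real.exp (∑ j ∈ range J,
        (Real.exp (-(s * (j + 1))) / (1 - Real.exp (-(s * (j + 1))))) / ((j : ℝ) + 1)))) := by
    refine (Real.continuous_exp.tendsto _).comp (tendsto_finsetSum _ fun j _ => ?_)
    exact (hasSum_exp_neg_pow_succ (by positivity)).tendsto_sum_nat.div_const _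
  refine le_trans (Real.exp_le_exp.2 ?_) (le_of_tendsto' hlim hM)
  have hJ : (J : ℝ) = ∑ j ∈ range J, (1 : ℝ) := by simp
  rw [hJ, sum_div, ← sum_sub_distrib]
  refine sum_le_sum fun j _ => ?_
  have ht : 0 < s * ((j : ℝ) + 1) := by positivity
  calc 1 / ((j : ℝ) + 1) ^ 2 / s - 1 ≤ 1 / ((j : ℝ) + 1) ^ 2 / s - 1 / ((j : ℝ) + 1) := by
        gcongr
        rw [div_le_one (by positivity)]
        linarith [(Nat.cast_nonneg j : (0 : ℝ) ≤ j)]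
    _ = (1 / (s * ((j : ℝ) + 1)) - 1) / ((j : ℝ) + 1) := by field_simp
    _ ≤ _ := by
        gcongr
        exact le_exp_neg_div_one_sub_exp_neg ht

theorem eventually_exp_le_tsum_card_partition {τ : ℝ} (hτ : 0 < τ) :
    ∀ᶠ s in nhdsWithin (0 : ℝ) (Set.Ioi 0), Real.exp ((1 - τ) * (Real.pi ^ 2 / 6) / s) ≤
      ∑' n : ℕ, (Fintype.card n.Partition : ℝ) * Real.exp (-s) ^ n := by
  have hA : 0 < Real.pi ^ 2 / 6 := by positivity
  obtain ⟨J, hJ⟩ := (hasSum_inv_succ_sq.tendsto_sum_nat.eventually_const_lt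
    (show (1 - τ / 2) * (Real.pi ^ 2 / 6) < Real.pi ^ 2 / 6 by nlinarith)).exists
  have h0 : Tendsto (fun s : ℝ => s * J) (nhdsWithin 0 (Set.Ioi 0)) (nhds 0) := by
    have : Tendsto (fun s : ℝ => s * J) (nhds 0) (nhds (0 * J)) :=
      (continuous_id.mul continuous_const).tendsto 0
    simpa using this.mono_left nhdsWithin_le_nhds
  filter_upwards [h0.eventually_lt_const (show 0 < τ / 2 * (Real.pi ^ 2 / 6) by positivity),
    self_mem_nhdsWithin] with s hs hs0
  have hs0 : 0 < s := hs0
  refine le_trans (Real.exp_le_exp.2 ?_) (le_tsum_card_partition hs0 J)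
  rw [le_sub_iff_add_le, div_add' _ _ _ hs0.ne']
  gcongr
  linarith

theorem sq_pi_div_sqrt_six : (Real.pi / √6) ^ 2 = Real.pi ^ 2 / 6 := by
  rw [div_pow, Real.sq_sqrt (by norm_num)]

/-- The upper bound `p(n) ≤ exp (2π √n / √6)` for the partition function. -/
theorem card_partition_le_exp (n : ℕ) :
    (Fintype.card n.Partition : ℝ) ≤ Real.exp (2 * (Real.pi / √6) * √n) := by
  rcases n.eq_zero_or_pos with rfl | hn
  · simp
  set α := Real.pi / √6 with hα
  have hα0 : 0 < α := by positivity
  have hw : 0 < √(n : ℝ) := Real.sqrt_pos.2 (by exact_mod_cast hn)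
  have hw2 : √(n : ℝ) ^ 2 = n := Real.sq_sqrt (by positivity)
  set w := √(n : ℝ)
  have h := card_partition_mul_exp_le (div_pos hα0 hw) n
  rw [← sq_pi_div_sqrt_six, ← hα, ← Real.exp_nat_mul, ← le_div_iff₀ (Real.exp_pos _),
    ← Real.exp_sub] at h
  refine h.trans (Real.exp_le_exp.2 (le_of_eq ?_))
  rw [← hw2]
  field_simp
  ring

theorem exists_tsum_card_partition_mul_le {s τ : ℝ} (hs : 0 < s) (hτ : 0 < τ) :
    ∃ m : ℕ, (∑' n : ℕ, (Fintype.card n.Partition : ℝ) * Real.exp (-s) ^ n) *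
      (1 - Real.exp (-(s * τ))) ≤ (Fintype.card m.Partition : ℝ) * Real.exp (-(s * (1 - τ))) ^ m := by
  by_contra! h
  set F := ∑' n : ℕ, (Fintype.card n.Partition : ℝ) * Real.exp (-s) ^ n with hF
  have h1 : Real.exp (-(s * τ)) < 1 := Real.exp_lt_one_iff.2 (by nlinarith)
  have hlt : ∀ n : ℕ, (Fintype.card n.Partition : ℝ) * Real.exp (-s) ^ n <
      F * (1 - Real.exp (-(s * τ))) * Real.exp (-(s * τ)) ^ n := fun n => by
    have := mul_lt_mul_of_pos_right (h n) (pow_pos (Real.exp_pos (-(s * τ))) n)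
    rwa [mul_assoc, ← mul_pow, ← Real.exp_add,
      show -(s * (1 - τ)) + -(s * τ) = -s by ring] at this
  have := hasSum_lt (fun n => (hlt n).le) (hlt 0) (summable_card_partition hs).hasSum
    ((hasSum_geometric_of_lt_one (Real.exp_pos _).le h1).mul_left _)
  rw [mul_assoc, mul_inv_cancel₀ (by linarith), mul_one] at this
  exact lt_irrefl _ this

theorem eventually_exp_neg_div_le {c d : ℝ} (hc : 0 < c) (hd : 0 < d) :
    ∀ᶠ s in nhdsWithin (0 : ℝ) (Set.Ioi 0), Real.exp (-(c / s)) ≤ 1 - Real.exp (-(s * d)) := by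
  have hcont : Continuous fun s : ℝ => 2 * s * (1 + s * d) := by fun_prop
  have h0 := (hcont.tendsto 0).mono_left (nhdsWithin_le_nhds (s := Set.Ioi 0))
  filter_upwards [h0.eventually_lt_const (show 2 * 0 * (1 + 0 * d) < c ^ 2 * d by simp; positivity),
    self_mem_nhdsWithin] with s hs hs0
  have hs0 : 0 < s := hs0
  have hsd : 0 < s * d := by positivity
  have h1 : Real.exp (-(c / s)) ≤ 2 * s ^ 2 / c ^ 2 := by
    rw [Real.exp_neg, inv_le_comm₀ (Real.exp_pos _) (by positivity)]
    have := Real.quadratic_le_exp_of_nonneg (div_pos hc hs0).le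
    have h2 : (2 * s ^ 2 / c ^ 2)⁻¹ = (c / s) ^ 2 / 2 := by field_simp
    have := div_pos hc hs0
    linarith
  have h2 : Real.exp (-(s * d)) ≤ 1 / (1 + s * d) := by
    rw [Real.exp_neg, one_div]
    gcongr
    linarith [Real.add_one_le_exp (s * d)]
  have h3 : 2 * s ^ 2 / c ^ 2 ≤ 1 - 1 / (1 + s * d) := by
    rw [one_sub_div (by positivity), div_le_div_iff₀ (by positivity) (by positivity)]
    nlinarith
  linarith

theorem tendsto_div_sqrt_natCast_nhdsGT_zero {c : ℝ} (hc : 0 < c) :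
    Tendsto (fun n : ℕ => c / √(n : ℝ)) atTop (nhdsWithin 0 (Set.Ioi 0)) := by
  refine tendsto_nhdsWithin_iff.2 ⟨?_, ?_⟩
  · exact (Real.tendsto_sqrt_atTop.comp tendsto_natCast_atTop_atTop).const_div_atTop c
  · filter_upwards [eventually_gt_atTop 0] with n hn
    have : 0 < √(n : ℝ) := Real.sqrt_pos.2 (by exact_mod_cast hn)
    exact div_pos hc this

theorem abs_sub_one_le_of_quadratic_le {η τ v : ℝ} (hη : 0 < η) (hη1 : η ≤ 1)
    (hτ : 6 * τ = η ^ 2) (h : (1 - τ) * (1 + v ^ 2) ≤ 2 * v) : |v - 1| ≤ η := by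
  refine abs_le_of_sq_le_sq ?_ hη.le
  have hτ0 : 0 ≤ τ := by linarith [sq_nonneg η]
  have hτ1 : τ ≤ 1 / 6 := by nlinarith
  have h1 := mul_nonneg hτ0 (sq_nonneg (v - 2))
  have h2 := mul_nonneg (sub_nonneg.2 hτ1) (sq_nonneg (v - 1))
  linarith

/-- The lower bound `p(n) ≥ exp ((2π / √6 - ε) √n)` for the partition function. -/
theorem eventually_exp_le_card_partition {η : ℝ} (hη : 0 < η) (hη1 : η ≤ 1) :
    ∀ᶠ n : ℕ in atTop,
      Real.exp (2 * (Real.pi / √6) * (1 - 3 * η) * √n) ≤ (Fintype.card n.Partition : ℝ) := by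
  set α := Real.pi / √6 with hα
  have hα0 : 0 < α := by positivity
  set τ := η ^ 2 / 6 with hτ
  have hτ0 : 0 < τ := by positivity
  have hτη : 6 * τ = η ^ 2 := by rw [hτ]; ring
  have hlim := tendsto_div_sqrt_natCast_nhdsGT_zero (c := α * (1 + η)) (by positivity)
  filter_upwards [hlim.eventually (eventually_exp_le_tsum_card_partition (half_pos hτ0)),
    hlim.eventually (eventually_exp_neg_div_le (c := τ / 2 * α ^ 2) (by positivity) hτ0),
    eventually_gt_atTop 0] with n h1 h2 hn
  have hw : 0 < √(n : ℝ) := Real.sqrt_pos.2 (by exact_mod_cast hn)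
  set w := √(n : ℝ)
  have hs : 0 < α * (1 + η) / w := by positivity
  obtain ⟨m, hm⟩ := exists_tsum_card_partition_mul_le hs hτ0
  set s := α * (1 + η) / w with hsdef
  rw [← sq_pi_div_sqrt_six, ← hα] at h1
  have hr : √(m : ℝ) ^ 2 = m := Real.sq_sqrt (by positivity)
  set r := √(m : ℝ) with hrdef
  have hr0 : 0 ≤ r := Real.sqrt_nonneg _
  have hE : (1 - τ / 2) * α ^ 2 / s + -(τ / 2 * α ^ 2 / s) + s * (1 - τ) * m =
      (1 - τ) * α * w / (1 + η) * (1 + ((1 + η) * r / w) ^ 2) := by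
    rw [← hr, hsdef]
    field_simp
    ring
  have hlow : Real.exp ((1 - τ) * α * w / (1 + η) * (1 + ((1 + η) * r / w) ^ 2)) ≤
      (Fintype.card m.Partition : ℝ) := by
    have h3 := (mul_le_mul h1 h2 (Real.exp_pos _).le ((Real.exp_pos _).le.trans h1)).trans hm
    rw [← Real.exp_add, ← Real.exp_nat_mul, ← div_le_iff₀ (Real.exp_pos _), ← Real.exp_sub] at h3
    rw [← hE]
    exact le_trans (Real.exp_le_exp.2 (by linarith)) h3
  have hup := Real.exp_le_exp.1 (hlow.trans (card_partition_le_exp m))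
  rw [← hα, ← hrdef] at hup
  have hv0 : 0 ≤ (1 + η) * r / w := by positivity
  have hv : r = (1 + η) * r / w * w / (1 + η) := by field_simp
  set v := (1 + η) * r / w
  have hquad : (1 - τ) * (1 + v ^ 2) ≤ 2 * v := by
    rw [hv] at hup
    have h4 : α * w / (1 + η) * ((1 - τ) * (1 + v ^ 2)) ≤ α * w / (1 + η) * (2 * v) := by
      convert hup using 1 <;> ring
    exact le_of_mul_le_mul_left h4 (by positivity)
  obtain ⟨hv1, hv2⟩ := abs_le.1 (abs_sub_one_le_of_quadratic_le hη hη1 hτη hquad)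
  have hmn : m ≤ n := by
    have : r ≤ w := by
      rw [hv, div_le_iff₀ (by positivity)]
      nlinarith
    exact_mod_cast (Real.sqrt_le_sqrt_iff (by positivity)).1 this
  refine le_trans (Real.exp_le_exp.2 ?_) (hlow.trans (by exact_mod_cast card_partition_mono hmn))
  have h5 : 2 * (1 - 3 * η) * (1 + η) ≤ (1 - τ) * (1 + v ^ 2) := by
    have h6 : 1 - η ≤ 1 - τ := by nlinarith
    have h7 : 2 * (1 - η) ≤ 1 + v ^ 2 := by linarith [sq_nonneg (v - 1)]
    have h8 := mul_le_mul h6 h7 (by linarith) (by linarith)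
    linarith [sq_nonneg η]
  calc 2 * α * (1 - 3 * η) * w = α * w / (1 + η) * (2 * (1 - 3 * η) * (1 + η)) := by field_simp
    _ ≤ α * w / (1 + η) * ((1 - τ) * (1 + v ^ 2)) := by gcongr
    _ = _ := by ring

theorem card_sigma_pi_partition_le {k N : ℕ} (S : Set (Fin k → Fin (N + 1))) {B : ℝ} (hB : 0 ≤ B)
    (h : ∀ t ∈ S, ∏ i, (Fintype.card (Nat.Partition (t i)) : ℝ) ≤ B) :
    (Nat.card (Σ t : S, ∀ i, Nat.Partition (t.1 i)) : ℝ) ≤ ((N : ℝ) + 1) ^ k * B := by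
  classical
  rw [Nat.card_eq_fintype_card, Fintype.card_sigma]
  push_cast [Fintype.card_pi]
  calc ∑ t : S, ∏ i, (Fintype.card (Nat.Partition (t.1 i)) : ℝ)
      ≤ ∑ _t : S, B := Finset.sum_le_sum fun t _ => h t.1 t.2
    _ = (Fintype.card S : ℝ) * B := by simp
    _ ≤ ((N : ℝ) + 1) ^ k * B := by
        gcongr
        calc (Fintype.card S : ℝ) ≤ (Fintype.card (Fin k → Fin (N + 1)) : ℝ) := by
              exact_mod_cast Fintype.card_subtype_le _
          _ = ((N : ℝ) + 1) ^ k := by simp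

namespace Multipartition

variable {k N : ℕ}

theorem size_le (μ : Multipartition k N) (i : Fin k) : (μ.1 i).1 ≤ N :=
  (Finset.single_le_sum (f := fun i => (μ.1 i).1) (fun _ _ => Nat.zero_le _)
    (Finset.mem_univ i)).trans_eq μ.2

/-- The tuple of sizes of a multipartition. -/
def sizes (μ : Multipartition k N) (i : Fin k) : Fin (N + 1) :=
  ⟨(μ.1 i).1, Nat.lt_succ_of_le (μ.size_le i)⟩

/-- A multipartition with sizes in `S`, as a tuple of sizes with a partition of each size. -/
def toSigma (S : Set (Fin k → Fin (N + 1))) (μ : { μ : Multipartition k N // μ.sizes ∈ S }) :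
    Σ t : S, ∀ i, Nat.Partition (t.1 i) :=
  ⟨⟨μ.1.sizes, μ.2⟩, fun i => (μ.1.1 i).2⟩

theorem toSigma_injective (S : Set (Fin k → Fin (N + 1))) : Function.Injective (toSigma S) := by
  intro μ ν h
  have := congrArg (fun (x : Σ t : S, ∀ i, Nat.Partition (t.1 i)) (i : Fin k) =>
    (⟨x.1.1 i, x.2 i⟩ : Σ n : ℕ, n.Partition)) h
  exact Subtype.ext (Subtype.ext this)

instance : Finite (Multipartition k N) :=
  Finite.of_injective (fun μ => toSigma Set.univ ⟨μ, trivial⟩) fun _ _ h =>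
    congrArg Subtype.val (toSigma_injective Set.univ h)

theorem card_sizes_mem_le (S : Set (Fin k → Fin (N + 1))) {B : ℝ} (hB : 0 ≤ B)
    (h : ∀ t ∈ S, ∏ i, (Fintype.card (Nat.Partition (t i)) : ℝ) ≤ B) :
    (Nat.card { μ : Multipartition k N // μ.sizes ∈ S } : ℝ) ≤ ((N : ℝ) + 1) ^ k * B := by
  refine le_trans ?_ (card_sigma_pi_partition_le S hB h)
  exact_mod_cast Nat.card_le_card_of_injective _ (toSigma_injective S)

theorem prod_card_le_card (t : Fin k → ℕ) (ht : ∑ i, t i = N) :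
    ∏ i, Fintype.card (t i).Partition ≤ Nat.card (Multipartition k N) := by
  classical
  rw [← Fintype.card_pi, ← Nat.card_eq_fintype_card]
  refine Nat.card_le_card_of_injective
    (fun p => (⟨fun i => ⟨t i, p i⟩, ht⟩ : Multipartition k N)) fun p q h => ?_
  funext i
  simpa using congrFun (congrArg Subtype.val h) i

theorem card_partition_div_pow_le_card (hk : k ≠ 0) :
    Fintype.card (N / k).Partition ^ k ≤ Nat.card (Multipartition k N) := by
  obtain ⟨k, rfl⟩ := Nat.exists_eq_succ_of_ne_zero hk
  have hmul : N / (k + 1) * (k + 1) ≤ N := Nat.div_mul_le_self N (k + 1)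
  refine le_trans ?_ (prod_card_le_card
    (Fin.cons (N - k * (N / (k + 1))) fun _ => N / (k + 1)) ?_)
  · rw [Fin.prod_univ_succ, pow_succ']
    simp only [Fin.cons_zero, Fin.cons_succ, Finset.prod_const, Finset.card_univ, Fintype.card_fin]
    gcongr
    apply card_partition_mono
    rw [Nat.le_sub_iff_add_le (by nlinarith)]
    nlinarith
  · rw [Fin.sum_univ_succ]
    simp only [Fin.cons_zero, Fin.cons_succ, Finset.sum_const, Finset.card_univ, Fintype.card_fin,
      smul_eq_mul]
    exact Nat.sub_add_cancel (by nlinarith)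

end Multipartition

theorem sum_sqrt_le_of_deviation {ι : Type*} [Fintype ι] {t : ι → ℝ} (ht : ∀ i, 0 ≤ t i) {a δ : ℝ}
    (ha : 0 < a) (hδ : 0 ≤ δ) (hsum : ∑ i, t i = Fintype.card ι * a ^ 2) {j : ι}
    (hj : δ * a ^ 2 ≤ |t j - a ^ 2|) :
    ∑ i, √(t i) ≤ Fintype.card ι * a - δ ^ 2 / (2 * (√(Fintype.card ι) + 1) ^ 2) * a := by
  set q := √(Fintype.card ι : ℝ)
  have hq : 0 ≤ q := Real.sqrt_nonneg _
  have hj0 := Real.sqrt_nonneg (t j)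
  have hle : √(t j) ≤ q * a := by
    rw [← Real.sqrt_sq ha.le, ← Real.sqrt_mul (by positivity), ← hsum]
    exact Real.sqrt_le_sqrt (Finset.single_le_sum (fun i _ => ht i) (Finset.mem_univ j))
  have hdev : δ * a ≤ |√(t j) - a| * (q + 1) := by
    have h1 : |t j - a ^ 2| = |√(t j) - a| * (√(t j) + a) := by
      rw [← abs_of_nonneg (add_nonneg hj0 ha.le), ← abs_mul]
      congr 1
      rw [← Real.sq_sqrt (ht j), Real.sqrt_sq hj0]
      ring
    have h2 : δ * a * a ≤ |√(t j) - a| * (q + 1) * a := by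
      calc δ * a * a = δ * a ^ 2 := by ring
        _ ≤ |√(t j) - a| * (√(t j) + a) := hj.trans_eq h1
        _ ≤ |√(t j) - a| * (q * a + a) := by gcongr
        _ = _ := by ring
    exact le_of_mul_le_mul_right h2 ha
  have hsq : δ ^ 2 * a ^ 2 ≤ (√(t j) - a) ^ 2 * (q + 1) ^ 2 := by
    rw [← mul_pow, ← sq_abs (√(t j) - a), ← mul_pow]
    gcongr
  have hvar : (√(t j) - a) ^ 2 ≤ 2 * a * (Fintype.card ι * a - ∑ i, √(t i)) := by
    calc (√(t j) - a) ^ 2 ≤ ∑ i, (√(t i) - a) ^ 2 :=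
          Finset.single_le_sum (f := fun i => (√(t i) - a) ^ 2) (fun _ _ => sq_nonneg _)
            (Finset.mem_univ j)
      _ = ∑ i, (t i - 2 * a * √(t i) + a ^ 2) :=
          Finset.sum_congr rfl fun i _ => by rw [sub_sq, Real.sq_sqrt (ht i)]; ring
      _ = _ := by
          rw [Finset.sum_add_distrib, Finset.sum_sub_distrib, hsum, ← Finset.mul_sum]
          simp
          ring
  have hfin : δ ^ 2 * a ^ 2 ≤ 2 * a * (Fintype.card ι * a - ∑ i, √(t i)) * (q + 1) ^ 2 :=
    hsq.trans (by gcongr)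
  have : δ ^ 2 / (2 * (q + 1) ^ 2) * a ≤ Fintype.card ι * a - ∑ i, √(t i) := by
    rw [div_mul_eq_mul_div, div_le_iff₀ (by positivity)]
    refine le_of_mul_le_mul_right (a := a) ?_ ha
    linarith
  linarith

theorem tendsto_add_one_pow_mul_exp_neg_sqrt (k : ℕ) {β : ℝ} (hβ : 0 < β) :
    Tendsto (fun N : ℕ => ((N : ℝ) + 1) ^ k * Real.exp (-(β * √(N : ℝ)))) atTop (nhds 0) := by
  have hy : Tendsto (fun N : ℕ => β * (√(N : ℝ) + 1)) atTop atTop :=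
    (tendsto_atTop_add_const_right _ _
      (Real.tendsto_sqrt_atTop.comp tendsto_natCast_atTop_atTop)).const_mul_atTop hβ
  have hlim := ((Real.tendsto_pow_mul_exp_neg_atTop_nhds_zero (2 * k)).comp hy).const_mul
    (Real.exp β / β ^ (2 * k))
  rw [mul_zero] at hlim
  refine squeeze_zero (fun _ => by positivity) (fun N => ?_) hlim
  have hw := Real.sqrt_nonneg (N : ℝ)
  have hw2 : √(N : ℝ) ^ 2 = N := Real.sq_sqrt (by positivity)
  calc ((N : ℝ) + 1) ^ k * Real.exp (-(β * √(N : ℝ)))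
      ≤ ((√(N : ℝ) + 1) ^ 2) ^ k * Real.exp (-(β * √(N : ℝ))) := by
        gcongr
        linarith
    _ = Real.exp β / β ^ (2 * k) *
        ((β * (√(N : ℝ) + 1)) ^ (2 * k) * Real.exp (-(β * (√(N : ℝ) + 1)))) := by
        rw [show -(β * √(N : ℝ)) = β + -(β * (√(N : ℝ) + 1)) by ring, Real.exp_add, mul_pow,
          ← pow_mul]
        field_simp

theorem sqrt_div_sub_one_le_sqrt_natDiv (N k : ℕ) :
    √((N : ℝ) / k) - 1 ≤ √((N / k : ℕ) : ℝ) := by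
  rw [sub_le_iff_le_add, Real.sqrt_le_left (by positivity), add_sq, Real.sq_sqrt (by positivity)]
  have h1 : (N : ℝ) / k < (N / k : ℕ) + 1 := by
    rw [← Nat.floor_div_eq_div (K := ℝ)]
    exact Nat.lt_floor_add_one _
  linarith [Real.sqrt_nonneg ((N / k : ℕ) : ℝ)]

namespace Multipartition

theorem card_deviation_le {k N : ℕ} (hk : k ≠ 0) (hN : 0 < N) {δ : ℝ} (hδ : 0 ≤ δ) :
    (Nat.card { μ : Multipartition k N // ∃ i, δ * ((N : ℝ) / k) ≤ |((μ.1 i).1 : ℝ) - N / k| } : ℝ) ≤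
      ((N : ℝ) + 1) ^ k * Real.exp (2 * (Real.pi / √6) *
        (k * √((N : ℝ) / k) - δ ^ 2 / (2 * (√k + 1) ^ 2) * √((N : ℝ) / k))) := by
  have hk0 : (0 : ℝ) < k := by exact_mod_cast Nat.pos_of_ne_zero hk
  have hN0 : (0 : ℝ) < N := by exact_mod_cast hN
  have ha : 0 < √((N : ℝ) / k) := Real.sqrt_pos.2 (by positivity)
  have ha2 : √((N : ℝ) / k) ^ 2 = N / k := Real.sq_sqrt (by positivity)
  let S : Set (Fin k → Fin (N + 1)) :=
    {t | ∑ i, (t i : ℕ) = N ∧ ∃ i, δ * ((N : ℝ) / k) ≤ |((t i : ℕ) : ℝ) - N / k|}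
  refine le_trans ?_ (card_sizes_mem_le S (Real.exp_pos _).le ?_)
  · refine Nat.cast_le.2 (Nat.card_le_card_of_injective
      (fun μ => (⟨μ.1, μ.1.2, μ.2⟩ : { μ : Multipartition k N // μ.sizes ∈ S })) fun μ ν h => ?_)
    exact Subtype.ext (congrArg (fun x => x.1) h)
  · rintro t ⟨hsum, j, hj⟩
    have hsum' : ∑ i, ((t i : ℕ) : ℝ) = N := by exact_mod_cast hsum
    have h := sum_sqrt_le_of_deviation (t := fun i => ((t i : ℕ) : ℝ)) (fun _ => by positivity) ha hδ
      (by rw [hsum', ha2, Fintype.card_fin]; field_simp) (j := j) (by rwa [ha2])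
    rw [Fintype.card_fin] at h
    calc ∏ i, (Fintype.card (Nat.Partition (t i)) : ℝ)
        ≤ ∏ i, Real.exp (2 * (Real.pi / √6) * √((t i : ℕ) : ℝ)) :=
          Finset.prod_le_prod (fun _ _ => by positivity) fun i _ => card_partition_le_exp (t i)
      _ = Real.exp (2 * (Real.pi / √6) * ∑ i, √((t i : ℕ) : ℝ)) := by
          rw [← Real.exp_sum, Finset.mul_sum]
      _ ≤ _ := by gcongr

theorem eventually_exp_le_card {k : ℕ} (hk : k ≠ 0) {ε : ℝ} (hε : 0 < ε) :
    ∀ᶠ N : ℕ in atTop,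
      Real.exp (2 * (Real.pi / √6) * (k * √((N : ℝ) / k) - k - ε * √((N : ℝ) / k))) ≤
        (Nat.card (Multipartition k N) : ℝ) := by
  have hk0 : (0 : ℝ) < k := by exact_mod_cast Nat.pos_of_ne_zero hk
  obtain ⟨η, hη, hη1, hη2⟩ : ∃ η : ℝ, 0 < η ∧ η ≤ 1 / 3 ∧ 3 * η * k ≤ ε := by
    refine ⟨min (1 / 3) (ε / (3 * k)), by positivity, min_le_left _ _, ?_⟩
    calc 3 * min (1 / 3) (ε / (3 * k)) * k ≤ 3 * (ε / (3 * k)) * k := by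
          gcongr
          exact min_le_right _ _
      _ = ε := by field_simp
  filter_upwards [(Nat.tendsto_div_const_atTop hk).eventually
    (eventually_exp_le_card_partition hη (by linarith))] with N hN
  have hfloor := sqrt_div_sub_one_le_sqrt_natDiv N k
  have ha := Real.sqrt_nonneg ((N : ℝ) / k)
  calc Real.exp (2 * (Real.pi / √6) * (k * √((N : ℝ) / k) - k - ε * √((N : ℝ) / k)))
      ≤ Real.exp (k * (2 * (Real.pi / √6) * (1 - 3 * η) * √((N / k : ℕ) : ℝ))) := by
        rw [show k * (2 * (Real.pi / √6) * (1 - 3 * η) * √((N / k : ℕ) : ℝ)) =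
          2 * (Real.pi / √6) * (k * (1 - 3 * η) * √((N / k : ℕ) : ℝ)) by ring]
        gcongr
        have h1 := mul_le_mul_of_nonneg_left hfloor
          (mul_nonneg hk0.le (by linarith : (0 : ℝ) ≤ 1 - 3 * η))
        have h2 := mul_le_mul_of_nonneg_right hη2 ha
        have h3 := mul_pos hη hk0
        linarith
    _ = Real.exp (2 * (Real.pi / √6) * (1 - 3 * η) * √((N / k : ℕ) : ℝ)) ^ k := Real.exp_nat_mul _ _
    _ ≤ (Fintype.card (N / k).Partition : ℝ) ^ k := by gcongr
    _ ≤ _ := by exact_mod_cast card_partition_div_pow_le_card hk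

theorem tendsto_card_deviation_div_card {k : ℕ} (hk : k ≠ 0) {δ : ℝ} (hδ : 0 < δ) :
    Tendsto (fun N : ℕ => (Nat.card { μ : Multipartition k N //
        ∃ i, δ * ((N : ℝ) / k) ≤ |((μ.1 i).1 : ℝ) - N / k| } : ℝ) /
        (Nat.card (Multipartition k N) : ℝ)) atTop (nhds 0) := by
  have hk0 : (0 : ℝ) < k := by exact_mod_cast Nat.pos_of_ne_zero hk
  set c := δ ^ 2 / (2 * (√k + 1) ^ 2) with hc
  have hc0 : 0 < c := by positivity
  have hβ : 0 < Real.pi / √6 * c / √k := by positivity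
  have hlim := (tendsto_add_one_pow_mul_exp_neg_sqrt k hβ).const_mul
    (Real.exp (2 * (Real.pi / √6) * k))
  rw [mul_zero] at hlim
  refine squeeze_zero' (Eventually.of_forall fun _ => by positivity) ?_ hlim
  filter_upwards [eventually_exp_le_card hk (half_pos hc0), eventually_gt_atTop 0] with N h1 hN
  have h2 := card_deviation_le hk hN hδ.le
  rw [← hc] at h2
  refine (div_le_div₀ (by positivity) h2 (Real.exp_pos _) h1).trans_eq ?_
  rw [mul_div_assoc, ← Real.exp_sub, mul_left_comm, ← Real.exp_add, Real.sqrt_div (by positivity)]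
  congr 2
  field_simp
  ring

end Multipartition

/-- For fixed `k ≥ 2` and any `δ > 0`, the proportion of
`k`-multipartitions `λ` of `N` with `(N/k)(1−δ) < |λ_i| < (N/k)(1+δ)` for
all `i` tends to `1` as `N → ∞`. -/
theorem multipartition_size_concentration (k : ℕ) (hk : 2 ≤ k) (δ : ℝ) (hδ : 0 < δ) :
    Tendsto
      (fun N : ℕ =>
        (Nat.card { μ : Multipartition k N //
            ∀ i, (N / k : ℝ) * (1 - δ) < ((μ.1 i).1 : ℝ) ∧
              ((μ.1 i).1 : ℝ) < (N / k : ℝ) * (1 + δ) } : ℝ) /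
          (Nat.card (Multipartition k N) : ℝ))
      atTop (nhds 1) := by
  have hk0 : k ≠ 0 := by omega
  have hlim := (Multipartition.tendsto_card_deviation_div_card hk0 hδ).const_sub 1
  rw [sub_zero] at hlim
  refine hlim.congr fun N => ?_
  have hpos : 0 < Nat.card (Multipartition k N) :=
    lt_of_lt_of_le (pow_pos Fintype.card_pos k) (Multipartition.card_partition_div_pow_le_card hk0)
  have hiff : ∀ μ : Multipartition k N,
      (∃ i, δ * ((N : ℝ) / k) ≤ |((μ.1 i).1 : ℝ) - N / k|) ↔
      ¬ ∀ i, (N / k : ℝ) * (1 - δ) < ((μ.1 i).1 : ℝ) ∧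
        ((μ.1 i).1 : ℝ) < (N / k : ℝ) * (1 + δ) := fun μ => by
    rw [not_forall]
    refine exists_congr fun i => ?_
    rw [← not_lt, abs_lt, not_iff_not]
    constructor <;> rintro ⟨h1, h2⟩ <;> constructor <;> linarith
  classical
  have hadd := Nat.card_congr (Equiv.sumCompl fun μ : Multipartition k N =>
    ∀ i, (N / k : ℝ) * (1 - δ) < ((μ.1 i).1 : ℝ) ∧ ((μ.1 i).1 : ℝ) < (N / k : ℝ) * (1 + δ))
  rw [Nat.card_sum, ← Nat.card_congr (Equiv.subtypeEquivRight hiff)] at hadd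
  have hadd' : (_ : ℝ) = _ := congrArg (Nat.cast) hadd
  push_cast at hadd'
  rw [one_sub_div (by positivity), ← hadd', add_sub_cancel_right]
end

section
/- Let p be a prime and let ∼_p be the equivalence relation on k-multipartitions of N generated by: μ ∼_p ν if there is an index j such that μ_i = ν_i for all i ≠ j, and ν_j is obtained from μ_j by replacing one part of size m·p with p parts of size m. If G is a finite group with integer-valued character table and k conjugacy classes, and μ ∼_p ν, then for every permutation module M^λ of G ≀ S_N, the character values satisfy M^λ(μ) ≡ M^λ(ν) (mod p). -/
open CategoryTheory
open scoped Classical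

/-- The index set of the rows of a `k`-multipartition (components given as multisets of
parts): a component index together with a position in the sorted list of its parts. -/
def RowIdx {k : ℕ} (μ : Fin k → Multiset ℕ) : Type :=
  Σ i : Fin k, Fin ((μ i).sort (· ≥ ·)).length

noncomputable instance {k : ℕ} (μ : Fin k → Multiset ℕ) : Fintype (RowIdx μ) := by
  unfold RowIdx; infer_instance

/-- The length of a row of a multipartition. -/
def rowSize {k : ℕ} (μ : Fin k → Multiset ℕ) (s : RowIdx μ) : ℕ :=
  ((μ s.1).sort (· ≥ ·)).get s.2

/-- A row decomposition of `λ` by `μ`: an assignment of the rows of `μ` to rows of `λ`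
such that the rows of `μ` assigned to a given row of `λ` have the same total length. -/
def IsRowDecomp {k : ℕ} (lam μ : Fin k → Multiset ℕ) (ρ : RowIdx μ → RowIdx lam) : Prop :=
  ∀ r : RowIdx lam,
    rowSize lam r = ∑ s ∈ Finset.univ.filter (fun s => ρ s = r), rowSize μ s

/-- The character value `M^λ(μ)` of the permutation module `M^λ` of `G ≀ S_N` at the
conjugacy class `μ`, computed by the row-decomposition character formula
(Proposition `perm_modules`): `M^λ_μ = ∑_{ρ ∈ RD(λ,μ)} α(ρ)`, where `ψ` is the
(integer-valued) character table of `G` and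
`α(ρ) = ∏_{rows s of μ} ψ (component of λ receiving s) (component of μ containing s)`. -/
noncomputable def permChar {k : ℕ} (ψ : Fin k → Fin k → ℤ)
    (lam μ : Fin k → Multiset ℕ) : ℤ :=
  ∑ ρ : { ρ : RowIdx μ → RowIdx lam // IsRowDecomp lam μ ρ },
    ∏ s : RowIdx μ, ψ (ρ.1 s).1 s.1

/-- One step of the relation generating `∼_p`: in component `j`, one part of size `m·p`
is replaced by `p` parts of size `m`. -/
def MashRel {ι : Type*} (p : ℕ) (μ ν : ι → Multiset ℕ) : Prop :=
  ∃ j m, 0 < m ∧ m * p ∈ μ j ∧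
    ν j = (μ j).erase (m * p) + Multiset.replicate p m ∧ ∀ i, i ≠ j → ν i = μ i

/-- The twisted power sum `∑_r ψ(component of r, j) X_r ^ m` over the rows `r` of `lam`, with
coefficients reduced modulo `p`. -/
noncomputable def twistedPowerSum {k : ℕ} (p : ℕ) (ψ : Fin k → Fin k → ℤ)
    (lam : Fin k → Multiset ℕ) (j : Fin k) (m : ℕ) : MvPolynomial (RowIdx lam) (ZMod p) :=
  ∑ r : RowIdx lam, MvPolynomial.monomial (Finsupp.single r m) (ψ r.1 j : ZMod p)

theorem twistedPowerSum_pow {k : ℕ} (p : ℕ) [Fact p.Prime] (ψ : Fin k → Fin k → ℤ)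
    (lam : Fin k → Multiset ℕ) (j : Fin k) (m : ℕ) :
    twistedPowerSum p ψ lam j m ^ p = twistedPowerSum p ψ lam j (m * p) := by
  simp [twistedPowerSum, sum_pow_char, MvPolynomial.monomial_pow, ZMod.pow_card, mul_comm]

theorem prod_rowIdx {k : ℕ} {M : Type*} [CommMonoid M] (μ : Fin k → Multiset ℕ)
    (f : Fin k → ℕ → M) :
    ∏ s : RowIdx μ, f s.1 (rowSize μ s) = ∏ i, ((μ i).map (f i)).prod := by
  have h : ∀ i, ((μ i).map (f i)).prod =
      ∏ t : Fin ((μ i).sort (· ≥ ·)).length, f i (((μ i).sort (· ≥ ·)).get t) := by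
    intro i
    conv_lhs => rw [← Multiset.sort_eq (μ i) (· ≥ ·)]
    rw [Multiset.map_coe, Multiset.prod_coe, ← List.prod_ofFn]
    congr 1
    apply List.ext_get <;> simp
  simp_rw [h]
  exact Fintype.prod_sigma _

theorem isRowDecomp_iff_sum_single {k : ℕ} (lam μ : Fin k → Multiset ℕ)
    (ρ : RowIdx μ → RowIdx lam) :
    IsRowDecomp lam μ ρ ↔
      ∑ s, Finsupp.single (ρ s) (rowSize μ s) = Finsupp.equivFunOnFinite.symm (rowSize lam) := by
  rw [Finsupp.ext_iff]
  refine forall_congr' fun r => ?_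
  simp [Finsupp.finsetSum_apply, Finsupp.single_apply, Finset.sum_filter,
    eq_comm (a := rowSize lam r)]

/-- The permutation character modulo `p` is a coefficient of a product of twisted power sums. -/
theorem permChar_cast_eq_coeff {k : ℕ} (p : ℕ) (ψ : Fin k → Fin k → ℤ)
    (lam μ : Fin k → Multiset ℕ) :
    (permChar ψ lam μ : ZMod p) =
      MvPolynomial.coeff (Finsupp.equivFunOnFinite.symm (rowSize lam))
        (∏ i, ((μ i).map (twistedPowerSum p ψ lam i)).prod) := by
  rw [← prod_rowIdx]
  simp only [twistedPowerSum, Finset.prod_univ_sum, Fintype.piFinset_univ,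
    ← MvPolynomial.monomial_sum_prod, MvPolynomial.coeff_sum, MvPolynomial.coeff_monomial,
    ← isRowDecomp_iff_sum_single, permChar]
  push_cast
  rw [← Finset.sum_filter]
  exact (Finset.sum_subtype _ (by simp)
    fun ρ : RowIdx μ → RowIdx lam => ∏ s, (ψ (ρ s).1 s.1 : ZMod p)).symm

theorem permChar_cast_eq_of_mashRel {k : ℕ} (p : ℕ) [Fact p.Prime] (ψ : Fin k → Fin k → ℤ)
    (lam : Fin k → Multiset ℕ) {μ ν : Fin k → Multiset ℕ} (h : MashRel p μ ν) :
    (permChar ψ lam μ : ZMod p) = permChar ψ lam ν := by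
  obtain ⟨j, m, -, hmem, hj, hne⟩ := h
  rw [permChar_cast_eq_coeff, permChar_cast_eq_coeff]
  congr 1
  refine Finset.prod_congr rfl fun i _ => ?_
  by_cases hi : i = j
  · subst hi
    rw [hj, Multiset.map_add, Multiset.prod_add, Multiset.map_replicate, Multiset.prod_replicate,
      twistedPowerSum_pow, mul_comm, Multiset.prod_map_erase hmem]
  · rw [hne i hi]

/-- Let `G` be a finite group with integer-valued character table `ψ` and
`k` conjugacy classes, and let `p` be a prime.  If `μ ∼_p ν` are `k`-multipartitions of
`N` (indexing conjugacy classes of `G ≀ S_N`), then for every `k`-multipartition `λ` of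
`N` the permutation module character satisfies `M^λ(μ) ≡ M^λ(ν) (mod p)`. -/
theorem perm_module_column_congruence (G : Type) [Group G] [Fintype G]
    (k : ℕ) (e : Fin k ≃ ConjClasses G)
    (Vi : Fin k → FDRep ℂ G) (hsimple : ∀ i, Simple (Vi i))
    (ψ : Fin k → Fin k → ℤ)
    (hψ : ∀ i j (g : G), ConjClasses.mk g = e j → (Vi i).character g = (ψ i j : ℂ))
    (p : ℕ) (hp : p.Prime) (N : ℕ)
    (μ ν lam : Fin k → Multiset ℕ)
    (hμ : ∑ i, (μ i).sum = N) (hν : ∑ i, (ν i).sum = N) (hlam : ∑ i, (lam i).sum = N)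
    (hμpos : ∀ i, ∀ m ∈ μ i, 0 < m) (hνpos : ∀ i, ∀ m ∈ ν i, 0 < m)
    (hlampos : ∀ i, ∀ m ∈ lam i, 0 < m)
    (hμν : Relation.EqvGen (MashRel p) μ ν) :
    (p : ℤ) ∣ permChar ψ lam μ - permChar ψ lam ν := by
  have : Fact p.Prime := ⟨hp⟩
  rw [← ZMod.intCast_eq_intCast_iff_dvd_sub]
  clear hμ hν hμpos hνpos
  induction hμν with
  | rel _ _ h => exact (permChar_cast_eq_of_mashRel p ψ lam h).symm
  | refl => rfl
  | symm _ _ _ ih => exact ih.symm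
  | trans _ _ _ _ _ ih₁ ih₂ => exact ih₂.trans ih₁
end
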